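/- Let K, B ∈ ℕ and let Φ be a set of constraints such that every φ ∈ Φ has dimension at most K (i.e., |P_φ| ≤ K) and is B-good (i.e., the set {gap_φ(t)(p) : t ∈ T_φ, p ∈ P_φ} is B-good). Then the entailment relation ⊑ is a well-quasi-order on Φ. -/

import Mathlib

universe u v w

/-- A gap quadruple `(lw, ls, uw, us)` with `lw, ls ∈ ℕ` and `uw, us ∈ ℕ ∪ {∞}`. -/
structure GapVal where
  lw : ℕ
  ls : ℕ
  uw : ℕ∞
  us : ℕ∞

/-- Well-formedness of a gap quadruple: either both upper bounds are finite,
or both are `∞`. -/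
def GapVal.WF (g : GapVal) : Prop :=
  (g.uw ≠ ⊤ ∧ g.us ≠ ⊤) ∨ (g.uw = ⊤ ∧ g.us = ⊤)

/-- A named gap over `Var`: a variable together with either `nreg`
(modelled by `none`) or a gap quadruple. -/
abbrev NamedGap (Var : Type u) := Var × Option GapVal

/-- A gap quadruple is free if both its upper bounds are `∞`. -/
def GapVal.Free (g : GapVal) : Prop := g.uw = ⊤ ∧ g.us = ⊤

/-- A gap quadruple is `B`-gap-bounded if both its upper bounds are at most `B`. -/
def GapVal.Bounded (B : ℕ) (g : GapVal) : Prop := g.uw ≤ (B : ℕ∞) ∧ g.us ≤ (B : ℕ∞)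

/-- The order `⊴` on named gaps, where `star` is the wildcard element of `Var`. -/
def gapLe {Var : Type u} (star : Var) (a b : NamedGap Var) : Prop :=
  (a.1 ≠ b.1 → a.1 = star) ∧
  (a.2 = none ↔ b.2 = none) ∧
  ∀ v v' : GapVal, a.2 = some v → b.2 = some v' →
    v.lw ≤ v'.lw ∧ v.ls ≤ v'.ls ∧ v'.uw ≤ v.uw ∧ v'.us ≤ v.us

/-- A set of named gaps is `B`-good if each of its elements carrying a gap
quadruple is free or `B`-gap-bounded. -/
def GoodSet {Var : Type u} (B : ℕ) (G : Set (NamedGap Var)) : Prop :=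
  ∀ g ∈ G, ∀ v : GapVal, g.2 = some v → v.Free ∨ v.Bounded B

/-- `r` is a well-quasi-order on the subset `S`: every infinite sequence of
elements of `S` contains indices `i < j` with `r (f i) (f j)`. -/
def IsWQOOn {α : Type u} (S : Set α) (r : α → α → Prop) : Prop :=
  ∀ f : ℕ → α, (∀ n, f n ∈ S) → ∃ i j, i < j ∧ r (f i) (f j)

/-- A task state of dimension `K`. -/
abbrev TaskState (UnrSuff : Type u) (Var : Type v) (K : ℕ) :=
  UnrSuff × (Fin K → NamedGap Var)

/-- The order `≼` on task states, where `starU` and `star` are the wildcard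
elements of `UnrSuff` and `Var` respectively. -/
def taskLe {UnrSuff : Type u} {Var : Type v} (starU : UnrSuff) (star : Var) {K : ℕ}
    (a b : TaskState UnrSuff Var K) : Prop :=
  (a.1 ≠ b.1 → a.1 = starU) ∧ ∀ k, gapLe star (a.2 k) (b.2 k)

/-- `A ∀∃≼ B`: every element of `A` is `r`-below some element of `B`. -/
def forallExists {α : Type u} (r : α → α → Prop) (A B : Multiset α) : Prop :=
  ∀ a ∈ A, ∃ b ∈ B, r a b

/-- `A ∃∀≼ B`: every element of `B` is `r`-above some element of `A`. -/
def existsForall {α : Type u} (r : α → α → Prop) (A B : Multiset α) : Prop :=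
  ∀ b ∈ B, ∃ a ∈ A, r a b

/-- A configuration: finite sets of tasks and phasers (modelled as finite sets
of naturals), a Boolean valuation, control sequences, and phases.  In a phase
`(var, some (w, s))`, `w` is the wait value and `s` the signal value, while
`(var, none)` means the task is not registered to the phaser. -/
structure Config (BV : Type u) (Var : Type v) (UnrSuff : Type w) where
  T : Finset ℕ
  P : Finset ℕ
  bv : BV → Bool
  seq : ℕ → UnrSuff
  phase : ℕ → ℕ → Var × Option (ℕ × ℕ)

/-- A constraint: finite sets of tasks and phasers, a Boolean valuation with
wildcard (`none` is `*`), control sequences, named gaps, and environment gaps. -/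
structure Constraint (BV : Type u) (Var : Type v) (UnrSuff : Type w) where
  T : Finset ℕ
  P : Finset ℕ
  bv : BV → Option Bool
  seq : ℕ → UnrSuff
  gap : ℕ → ℕ → NamedGap Var
  egap : ℕ → ℕ × ℕ

/-- `c ⊨ φ`: the configuration `c` is denoted by the constraint `φ`.
The inequalities `lw ≤ l − w ≤ uw` and `ls ≤ s − l ≤ us` are rendered
additively (`w + lw ≤ l`, etc.) to avoid truncated subtraction issues. -/
def Denotes {BV : Type u} {Var : Type v} {UnrSuff : Type w} (star : Var) (starU : UnrSuff)
    (φ : Constraint BV Var UnrSuff) (c : Config BV Var UnrSuff) : Prop :=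
  (∀ b, φ.bv b ≠ some (c.bv b) → φ.bv b = none) ∧
  ∃ T1 ⊆ c.T, ∃ P1 ⊆ c.P, ∃ τ : ℕ → ℕ, ∃ π : ℕ → ℕ,
    T1.image τ = φ.T ∧ Set.InjOn π ↑P1 ∧ P1.image π = φ.P ∧
    (∀ t ∈ T1, φ.seq (τ t) ≠ c.seq t → φ.seq (τ t) = starU) ∧
    ∀ p ∈ P1, ∃ l : ℕ,
      (∀ t ∈ T1,
        ((c.phase t p).1 ≠ (φ.gap (τ t) (π p)).1 → (φ.gap (τ t) (π p)).1 = star) ∧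
        ((c.phase t p).2 = none ↔ (φ.gap (τ t) (π p)).2 = none) ∧
        (∀ w s : ℕ, ∀ v : GapVal, (c.phase t p).2 = some (w, s) →
          (φ.gap (τ t) (π p)).2 = some v →
          w + v.lw ≤ l ∧ ((l - w : ℕ) : ℕ∞) ≤ v.uw ∧
          l + v.ls ≤ s ∧ ((s - l : ℕ) : ℕ∞) ≤ v.us)) ∧
      (∀ t ∈ c.T, t ∉ T1 → ∀ w s : ℕ, (c.phase t p).2 = some (w, s) →
        w + (φ.egap (π p)).1 ≤ l ∧ l + (φ.egap (π p)).2 ≤ s)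

/-- The denotation `⟦φ⟧` of a constraint. -/
def Denotation {BV : Type u} {Var : Type v} {UnrSuff : Type w} (star : Var) (starU : UnrSuff)
    (φ : Constraint BV Var UnrSuff) : Set (Config BV Var UnrSuff) :=
  {c | Denotes star starU φ c}

/-- `φa ⊑ φb`: the constraint `φa` is entailed by the constraint `φb`. -/
def Entails {BV : Type u} {Var : Type v} {UnrSuff : Type w} (star : Var) (starU : UnrSuff)
    (φa φb : Constraint BV Var UnrSuff) : Prop :=
  (∀ b, φa.bv b ≠ φb.bv b → φa.bv b = none) ∧
  ∃ T1 ⊆ φb.T, ∃ P1 ⊆ φb.P, ∃ τ : ℕ → ℕ, ∃ π : ℕ → ℕ,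
    T1.image τ = φa.T ∧ Set.InjOn π ↑P1 ∧ P1.image π = φa.P ∧
    (∀ t ∈ T1, φa.seq (τ t) ≠ φb.seq t → φa.seq (τ t) = starU) ∧
    ∀ p ∈ P1,
      ((φa.egap (π p)).1 ≤ (φb.egap p).1 ∧ (φa.egap (π p)).2 ≤ (φb.egap p).2) ∧
      (∀ t ∈ T1, gapLe star (φa.gap (τ t) (π p)) (φb.gap t p)) ∧
      (∀ t ∈ φb.T, t ∉ T1 → ∀ v : GapVal, (φb.gap t p).2 = some v →
        (φa.egap (π p)).1 ≤ v.lw ∧ (φa.egap (π p)).2 ≤ v.ls)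

/-- A constraint is `B`-good if all the named gaps of its tasks/phasers
carrying a quadruple are free or `B`-gap-bounded. -/
def ConstraintBGood {BV : Type u} {Var : Type v} {UnrSuff : Type w} (B : ℕ)
    (φ : Constraint BV Var UnrSuff) : Prop :=
  ∀ t ∈ φ.T, ∀ p ∈ φ.P, ∀ v : GapVal, (φ.gap t p).2 = some v → v.Free ∨ v.Bounded B

/-- An encoding of a constraint: `L` task indices, `M` phaser indices. -/
structure Encoding (BV : Type u) (Var : Type v) (UnrSuff : Type w) where
  L : ℕ
  M : ℕ
  bv : BV → Option Bool
  acc : Fin L → UnrSuff × (Fin M → NamedGap Var)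
  env : Fin M → ℕ × ℕ

/-- `e` enumerates the finite set `S` (this corresponds to choosing a total
order on `S`, the element of index `i` being `e i`). -/
def IsEnum (S : Finset ℕ) (e : Fin S.card → ℕ) : Prop :=
  Function.Injective e ∧ ∀ i, e i ∈ S

/-- The encoding `⌈φ⌉` of a constraint `φ` with respect to enumerations
(total orders) `eT` of its tasks and `eP` of its phasers. -/
def encodingOf {BV : Type u} {Var : Type v} {UnrSuff : Type w}
    (φ : Constraint BV Var UnrSuff)
    (eT : Fin φ.T.card → ℕ) (eP : Fin φ.P.card → ℕ) : Encoding BV Var UnrSuff where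
  L := φ.T.card
  M := φ.P.card
  bv := φ.bv
  acc := fun i => (φ.seq (eT i), fun j => φ.gap (eT i) (eP j))
  env := fun j => φ.egap (eP j)

/-- The entailment relation `⊑ₑ` on encodings. -/
def EncEntails {BV : Type u} {Var : Type v} {UnrSuff : Type w} (star : Var) (starU : UnrSuff)
    (e e' : Encoding BV Var UnrSuff) : Prop :=
  (∀ b, e.bv b ≠ e'.bv b → e.bv b = none) ∧
  ∃ hM : e.M = e'.M, ∃ h : Fin e'.L → Fin e.L, Function.Surjective h ∧
    (∀ i : Fin e'.L,
      ((e.acc (h i)).1 ≠ (e'.acc i).1 → (e.acc (h i)).1 = starU) ∧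
      ∀ j : Fin e.M, gapLe star ((e.acc (h i)).2 j) ((e'.acc i).2 (Fin.cast hM j))) ∧
    (∀ j : Fin e.M, (e.env j).1 ≤ (e'.env (Fin.cast hM j)).1 ∧
      (e.env j).2 ≤ (e'.env (Fin.cast hM j)).2)

/-- An encoding is `B`-good if every named gap occurring in it and carrying a
quadruple is free or `B`-gap-bounded. -/
def EncodingBGood {BV : Type u} {Var : Type v} {UnrSuff : Type w} (B : ℕ)
    (e : Encoding BV Var UnrSuff) : Prop :=
  ∀ (i : Fin e.L) (j : Fin e.M) (v : GapVal),
    ((e.acc i).2 j).2 = some v → v.Free ∨ v.Bounded B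

/-! ### Upper sets of `ι → ℕ` are well-quasi-ordered -/

/-- The slice at `i` of an upper set in `ℕ × α`. -/
def UpperSet.slice {α : Type*} [Preorder α] (s : UpperSet (ℕ × α)) (i : ℕ) : UpperSet α where
  carrier := {a | (i, a) ∈ s}
  upper' _ _ hab ha := s.upper (Prod.mk_le_mk.2 ⟨le_rfl, hab⟩) ha

theorem UpperSet.slice_antitone {α : Type*} [Preorder α] (s : UpperSet (ℕ × α)) :
    Antitone s.slice :=
  fun _ _ hij _ ha => s.upper (Prod.mk_le_mk.2 ⟨hij, le_rfl⟩) ha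

theorem UpperSet.exists_slice_stable {α : Type*} [Preorder α] [WellQuasiOrderedLE (UpperSet α)]
    (s : UpperSet (ℕ × α)) : ∃ N, ∀ m, N ≤ m → s.slice N = s.slice m :=
  WellFoundedLT.antitone_chain_condition s.slice_antitone

/-- **Higman's lemma** for relations on a whole type. -/
theorem WellQuasiOrdered.sublistForall₂ {α : Type*} {r : α → α → Prop} [IsPreorder α r]
    (h : WellQuasiOrdered r) : WellQuasiOrdered (List.SublistForall₂ r) := by
  have := Set.PartiallyWellOrderedOn.partiallyWellOrderedOn_sublistForall₂ r
    (Set.partiallyWellOrderedOn_univ_iff.2 h)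
  exact Set.partiallyWellOrderedOn_univ_iff.1 (by simpa using! this)

theorem List.SublistForall₂.exists_le_of_range {r : ℕ → ℕ → Prop} {m n : ℕ}
    (h : List.SublistForall₂ r (List.range m) (List.range n)) {k : ℕ} (hk : k < m) :
    ∃ l, k ≤ l ∧ r k l := by
  obtain ⟨l, hl, hsub⟩ := List.sublistForall₂_iff.1 h
  obtain ⟨f, hf⟩ := List.sublist_iff_exists_orderEmbedding_getElem?_eq.1 hsub
  have hlen : k < l.length := by simpa [← hl.length_eq] using hk
  have hr := hl.get (i := k) (by simpa using hk) hlen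
  have hfk := hf k
  rw [List.getElem?_eq_getElem hlen] at hfk
  have hfk' := List.mem_of_getElem? hfk.symm
  obtain ⟨hlt, heq⟩ := List.getElem?_eq_some_iff.1 hfk.symm
  rw [List.getElem_range] at heq
  refine ⟨f k, f.strictMono.le_apply, ?_⟩
  simpa [heq] using hr

theorem UpperSet.wellQuasiOrderedLE_nat_prod {α : Type*} [Preorder α]
    [WellQuasiOrderedLE (UpperSet α)] : WellQuasiOrderedLE (UpperSet (ℕ × α)) := by
  refine ⟨fun f => ?_⟩
  choose N hN using fun n => (f n).exists_slice_stable
  have hwqo := (wellQuasiOrdered_le (α := UpperSet α)).prod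
    (wellQuasiOrdered_le (α := UpperSet α)).sublistForall₂
  obtain ⟨i, j, hij, hlim, hsub⟩ := hwqo fun n =>
    ((f n).slice (N n), (List.range (N n + 1)).map (f n).slice)
  refine ⟨i, j, hij, ?_⟩
  suffices H : ∀ k, (f i).slice k ≤ (f j).slice k from fun x hx => H x.1 hx
  intro k
  rcases lt_or_ge k (N i + 1) with hk | hk
  · rw [List.sublistForall₂_map_left_iff, List.sublistForall₂_map_right_iff] at hsub
    obtain ⟨l, hkl, hl⟩ := hsub.exists_le_of_range hk
    exact hl.trans ((f j).slice_antitone hkl)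
  · rw [← hN i k (by omega)]
    refine hlim.trans ?_
    rcases le_total (N j) k with h | h
    · exact (hN j k h).le
    · exact (f j).slice_antitone h

/-- Monomial ideals are well-quasi-ordered by reverse inclusion (Maclagan). -/
theorem UpperSet.wellQuasiOrderedLE_pi_nat (ι : Type*) [Finite ι] :
    WellQuasiOrderedLE (UpperSet (ι → ℕ)) := by
  induction ι using Finite.induction_empty_option with
  | @of_equiv α β e h =>
    let E : (α → ℕ) ≃o (β → ℕ) :=
      { toEquiv := e.arrowCongr (Equiv.refl ℕ)
        map_rel_iff' := by
          intro a b
          simp [Pi.le_def, e.symm.surjective.forall] }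
    exact (UpperSet.map E).wellQuasiOrderedLE_iff.1 h
  | h_empty =>
    have : Finite (UpperSet (PEmpty → ℕ)) := Finite.of_injective _ SetLike.coe_injective
    exact Finite.to_wellQuasiOrderedLE
  | @h_option α _ h =>
    let E : (Option α → ℕ) ≃o ℕ × (α → ℕ) :=
      { toEquiv := Equiv.piOptionEquivProd
        map_rel_iff' := by
          intro a b
          simp [Pi.le_def, Option.forall, Equiv.piOptionEquivProd, Prod.le_def] }
    exact (UpperSet.map E).wellQuasiOrderedLE_iff.2 UpperSet.wellQuasiOrderedLE_nat_prod

/-! ### Coloured vectors -/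

/-- Equality of colours together with the pointwise order on vectors. -/
def colorLe {C ι : Type*} (a b : C × (ι → ℕ)) : Prop := a.1 = b.1 ∧ a.2 ≤ b.2

instance colorLe_isPreorder {C ι : Type*} :
    IsPreorder (C × (ι → ℕ)) colorLe where
  refl _ := ⟨rfl, le_rfl⟩
  trans _ _ _ hab hbc := ⟨hab.1.trans hbc.1, hab.2.trans hbc.2⟩

theorem wellQuasiOrdered_colorLe {C ι : Type*} [Finite C] [Finite ι] :
    WellQuasiOrdered (colorLe : C × (ι → ℕ) → C × (ι → ℕ) → Prop) :=
  (Finite.wellQuasiOrdered (Eq : C → C → Prop)).prod wellQuasiOrdered_le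

/-- The upper closure of the vectors of colour `c` labelling the elements of `T`. -/
def colorClosure {C ι : Type*} (T : Finset ℕ) (key : ℕ → C × (ι → ℕ)) (c : C) :
    UpperSet (ι → ℕ) :=
  upperClosure {x | ∃ t ∈ T, key t = (c, x)}

theorem exists_colorLe_of_colorClosure_le {C ι : Type*} {S T : Finset ℕ}
    {key key' : ℕ → C × (ι → ℕ)} (h : colorClosure S key ≤ colorClosure T key') {t : ℕ}
    (ht : t ∈ T) : ∃ s ∈ S, colorLe (key s) (key' t) := by
  have hmem : (key' t).2 ∈ colorClosure T key' (key' t).1 := subset_upperClosure ⟨t, ht, rfl⟩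
  obtain ⟨x, ⟨s, hs, hsx⟩, hx⟩ := mem_upperClosure.1 (h _ hmem)
  exact ⟨s, hs, by rw [hsx]; exact ⟨rfl, hx⟩⟩

theorem List.Forall₂.exists_map_eq {α β : Type*} {r : α → β → Prop} [Inhabited α] {l : List α}
    {l' : List β} (h : List.Forall₂ r l l') (hl' : l'.Nodup) :
    ∃ g : β → α, l'.map g = l ∧ ∀ b ∈ l', r (g b) b := by
  classical
  induction h with
  | nil => exact ⟨fun _ => default, rfl, by simp⟩
  | @cons a b l l' hab _ ih =>
    rw [List.nodup_cons] at hl'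
    obtain ⟨g, hg, hr⟩ := ih hl'.2
    have hne : ∀ c ∈ l', c ≠ b := fun c hc hcb => hl'.1 (hcb ▸ hc)
    refine ⟨Function.update g b a, ?_, ?_⟩
    · rw [List.map_cons, Function.update_self, ← hg]
      congr 1
      exact List.map_congr_left fun c hc => Function.update_of_ne (hne c hc) _ _
    · intro c hc
      rcases List.mem_cons.1 hc with rfl | hc
      · simpa using hab
      · rw [Function.update_of_ne (hne c hc)]
        exact hr c hc

/-- An embedding of `S` into `T` and a map from `T` to `S` below the identity combine into a
surjection from `T` onto `S` below the identity. -/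
theorem exists_image_eq_of_sublistForall₂ {S T : Finset ℕ} {r : ℕ → ℕ → Prop}
    (hsub : List.SublistForall₂ r S.toList T.toList) (hbelow : ∀ t ∈ T, ∃ s ∈ S, r s t) :
    ∃ τ : ℕ → ℕ, T.image τ = S ∧ ∀ t ∈ T, r (τ t) t := by
  classical
  obtain ⟨l, hl, hlT⟩ := List.sublistForall₂_iff.1 hsub
  obtain ⟨g, hgl, hgr⟩ := hl.exists_map_eq (hlT.nodup T.nodup_toList)
  choose! g' hg'S hg'r using hbelow
  have hmem : ∀ s, s ∈ S ↔ ∃ t ∈ l, g t = s := fun s => by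
    rw [← Finset.mem_toList, ← hgl, List.mem_map]
  refine ⟨fun t => if t ∈ l then g t else g' t, ?_, ?_⟩
  · ext s
    rw [Finset.mem_image]
    constructor
    · rintro ⟨t, ht, rfl⟩
      split_ifs with htl
      · exact (hmem _).2 ⟨t, htl, rfl⟩
      · exact hg'S t ht
    · intro hs
      obtain ⟨t, ht, rfl⟩ := (hmem s).1 hs
      exact ⟨t, Finset.mem_toList.1 (hlT.subset ht), if_pos ht⟩
  · intro t ht
    dsimp only
    split_ifs with htl
    · exact hgr t htl
    · exact hg'r t ht

theorem exists_lt_colorLe_and_image_eq {C D ι κ : Type*} [Finite C] [Finite D] [Finite ι]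
    [Finite κ] (aux : ℕ → D × (κ → ℕ)) (T : ℕ → Finset ℕ) (key : ℕ → ℕ → C × (ι → ℕ)) :
    ∃ i j, i < j ∧ colorLe (aux i) (aux j) ∧
      ∃ τ : ℕ → ℕ, (T j).image τ = T i ∧ ∀ t ∈ T j, colorLe (key i (τ t)) (key j t) := by
  have := UpperSet.wellQuasiOrderedLE_pi_nat ι
  have hwqo := (wellQuasiOrdered_colorLe (C := D) (ι := κ)).prod
    ((wellQuasiOrdered_le (α := C → UpperSet (ι → ℕ))).prod
      (wellQuasiOrdered_colorLe (C := C) (ι := ι)).sublistForall₂)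
  obtain ⟨i, j, hij, haux, hup, hsub⟩ := hwqo fun n =>
    (aux n, colorClosure (T n) (key n), (T n).toList.map (key n))
  rw [List.sublistForall₂_map_left_iff, List.sublistForall₂_map_right_iff] at hsub
  exact ⟨i, j, hij, haux, exists_image_eq_of_sublistForall₂ hsub fun t ht =>
    exists_colorLe_of_colorClosure_le hup ht⟩

/-! ### Matching the phasers of two constraints -/

/-- The order-preserving map between finite sets of naturals, with junk values outside. -/
noncomputable def Finset.rankMap (P Q : Finset ℕ) (p : ℕ) : ℕ := Nat.nth (· ∈ Q) (Nat.count (· ∈ P) p)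

theorem Finset.count_lt_card {P : Finset ℕ} {p : ℕ} (hp : p ∈ P) :
    Nat.count (· ∈ P) p < P.card := by
  simpa using Nat.count_lt_card (p := (· ∈ P)) P.finite_toSet hp

theorem Finset.nth_mem {P : Finset ℕ} {k : ℕ} (hk : k < P.card) : Nat.nth (· ∈ P) k ∈ P :=
  Nat.nth_mem (p := (· ∈ P)) k fun hf => by
    rwa [show hf.toFinset = P by ext; simp]

theorem Finset.count_nth {P : Finset ℕ} {k : ℕ} (hk : k < P.card) :
    Nat.count (· ∈ P) (Nat.nth (· ∈ P) k) = k :=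
  Nat.count_nth fun hf => by
    rwa [show hf.toFinset = P by ext; simp]

theorem Finset.rankMap_injOn {P Q : Finset ℕ} (h : P.card = Q.card) :
    Set.InjOn (P.rankMap Q) ↑P := by
  intro p hp q hq hpq
  have := congrArg (Nat.count (· ∈ Q)) hpq
  rw [rankMap, rankMap, count_nth (h ▸ count_lt_card hp),
    count_nth (h ▸ count_lt_card hq)] at this
  exact Nat.count_injective (p := (· ∈ P)) hp hq this

theorem Finset.image_rankMap {P Q : Finset ℕ} (h : P.card = Q.card) :
    P.image (P.rankMap Q) = Q := by
  refine Finset.eq_of_subset_of_card_le ?_ ?_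
  · intro q hq
    obtain ⟨p, hp, rfl⟩ := Finset.mem_image.1 hq
    exact nth_mem (h ▸ count_lt_card hp)
  · rw [Finset.card_image_of_injOn (rankMap_injOn h), h]

/-! ### Colouring constraints -/

/-- The finite-range code of an upper bound: exact for `⊤` and for values at most `B`. -/
noncomputable def boundCode (B : ℕ) (u : ℕ∞) : Option (Fin (B + 1)) :=
  if u = ⊤ then none else some (Fin.ofNat (B + 1) u.toNat)

theorem boundCode_inj {B : ℕ} {u u' : ℕ∞} (hu : u = ⊤ ∨ u ≤ B) (hu' : u' = ⊤ ∨ u' ≤ B)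
    (h : boundCode B u = boundCode B u') : u = u' := by
  induction u with
  | top => induction u' with
    | top => rfl
    | coe n => simp [boundCode] at h
  | coe m => induction u' with
    | top => simp [boundCode] at h
    | coe n =>
      have hm : m < B + 1 := Nat.lt_succ_of_le (by simpa using hu)
      have hn : n < B + 1 := Nat.lt_succ_of_le (by simpa using hu')
      simp only [boundCode, ENat.natCast_ne_top, if_false, ENat.toNat_natCast, Option.some.injEq,
        Fin.ext_iff, Fin.val_ofNat, Nat.mod_eq_of_lt hm, Nat.mod_eq_of_lt hn] at h
      rw [h]

/-- The colour of a named gap: its variable and the codes of its upper bounds. -/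
noncomputable def gapColor {Var : Type*} (B : ℕ) (g : NamedGap Var) :
    Var × Option (Option (Fin (B + 1)) × Option (Fin (B + 1))) :=
  (g.1, g.2.map fun v => (boundCode B v.uw, boundCode B v.us))

/-- The lower bounds of a named gap: `lw` at `true` and `ls` at `false`. -/
def gapLower {Var : Type*} (g : NamedGap Var) (b : Bool) : ℕ :=
  g.2.elim 0 fun v => if b then v.lw else v.ls

theorem gapLe_of_gapColor_eq {Var : Type*} {star : Var} {B : ℕ} {g g' : NamedGap Var}
    (hg : ∀ v, g.2 = some v → v.Free ∨ v.Bounded B)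
    (hg' : ∀ v, g'.2 = some v → v.Free ∨ v.Bounded B)
    (hcolor : gapColor B g = gapColor B g') (hlower : ∀ b, gapLower g b ≤ gapLower g' b) :
    gapLe star g g' := by
  obtain ⟨x, y⟩ := g
  obtain ⟨x', y'⟩ := g'
  simp only [gapColor, Prod.mk.injEq] at hcolor
  obtain ⟨rfl, hy⟩ := hcolor
  refine ⟨fun h => absurd rfl h, ?_, ?_⟩
  · cases y <;> cases y' <;> simp_all
  · rintro v v' h h'
    dsimp only at h h'
    subst h h'
    simp only [Option.map_some, Option.some.injEq, Prod.mk.injEq] at hy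
    have hv := hg v rfl
    have hv' := hg' v' rfl
    refine ⟨by simpa [gapLower] using hlower true, by simpa [gapLower] using hlower false, ?_, ?_⟩
    · exact (boundCode_inj (hv.imp And.left And.left) (hv'.imp And.left And.left) hy.1).ge
    · exact (boundCode_inj (hv.imp And.right And.right) (hv'.imp And.right And.right) hy.2).ge

/-- The colour and lower bounds of the task `t` with respect to the first `K` phasers. -/
noncomputable def Constraint.taskKey {BV Var UnrSuff : Type*} (K B : ℕ)
    (φ : Constraint BV Var UnrSuff) (t : ℕ) :
    (UnrSuff × (Fin K → Var × Option (Option (Fin (B + 1)) × Option (Fin (B + 1))))) ×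
      (Fin K × Bool → ℕ) :=
  ((φ.seq t, fun k => gapColor B (φ.gap t (Nat.nth (· ∈ φ.P) k))),
    fun kb => gapLower (φ.gap t (Nat.nth (· ∈ φ.P) kb.1)) kb.2)

/-- The Boolean valuation, the dimension and the environment gaps of a constraint. -/
noncomputable def Constraint.globalKey {BV Var UnrSuff : Type*} (K : ℕ)
    (φ : Constraint BV Var UnrSuff) : ((BV → Option Bool) × Fin (K + 1)) × (Fin K × Bool → ℕ) :=
  ((φ.bv, Fin.ofNat (K + 1) φ.P.card),
    fun kb => if kb.2 then (φ.egap (Nat.nth (· ∈ φ.P) kb.1)).1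
      else (φ.egap (Nat.nth (· ∈ φ.P) kb.1)).2)

theorem entails_of_colorLe {BV Var UnrSuff : Type*} {star : Var} {starU : UnrSuff} {K B : ℕ}
    {φ ψ : Constraint BV Var UnrSuff} (hφK : φ.P.card ≤ K) (hψK : ψ.P.card ≤ K)
    (hφ : ConstraintBGood B φ) (hψ : ConstraintBGood B ψ)
    (hglobal : colorLe (φ.globalKey K) (ψ.globalKey K)) {τ : ℕ → ℕ} (hτ : ψ.T.image τ = φ.T)
    (hkey : ∀ t ∈ ψ.T, colorLe (φ.taskKey K B (τ t)) (ψ.taskKey K B t)) :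
    Entails star starU φ ψ := by
  obtain ⟨hcolor, henv⟩ := hglobal
  simp only [Constraint.globalKey, Prod.mk.injEq, Fin.ext_iff, Fin.val_ofNat,
    Nat.mod_eq_of_lt (Nat.lt_succ_of_le hφK), Nat.mod_eq_of_lt (Nat.lt_succ_of_le hψK)] at hcolor
  obtain ⟨hbv, hcard⟩ := hcolor
  refine ⟨fun b hb => absurd (congrFun hbv b) hb, ψ.T, subset_rfl, ψ.P, subset_rfl, τ,
    ψ.P.rankMap φ.P, hτ, Finset.rankMap_injOn hcard.symm, Finset.image_rankMap hcard.symm,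
    fun t ht h => absurd (congrArg Prod.fst (hkey t ht).1) h, fun p hp => ?_⟩
  have hk : Nat.count (· ∈ ψ.P) p < ψ.P.card := Finset.count_lt_card hp
  have hnth : Nat.nth (· ∈ ψ.P) (Nat.count (· ∈ ψ.P) p) = p :=
    Nat.nth_count (p := (· ∈ ψ.P)) hp
  have hmem : ψ.P.rankMap φ.P p ∈ φ.P := Finset.nth_mem (hcard ▸ hk)
  let k : Fin K := ⟨Nat.count (· ∈ ψ.P) p, hk.trans_le hψK⟩
  refine ⟨⟨?_, ?_⟩, fun t ht => ?_, fun t ht ht' => absurd ht ht'⟩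
  · simpa [Constraint.globalKey, k, hnth] using! henv (k, true)
  · simpa [Constraint.globalKey, k, hnth] using! henv (k, false)
  · refine gapLe_of_gapColor_eq (hφ _ (hτ ▸ Finset.mem_image_of_mem τ ht) _ hmem)
      (hψ t ht p hp) ?_ fun b => ?_
    · have := congrFun (congrArg Prod.snd (hkey t ht).1) k
      simpa [Constraint.taskKey, k, hnth] using! this
    · simpa [Constraint.taskKey, k, hnth] using! (hkey t ht).2 (k, b)

/-- The entailment `⊑` is a well-quasi-order on any set of
constraints of dimension at most `K` that are all `B`-good. -/
theorem constraints_isWQO_entails {BV : Type u} {Var : Type v} {UnrSuff : Type w}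
    [Fintype BV] [Fintype Var] [Fintype UnrSuff] (star : Var) (starU : UnrSuff)
    (K B : ℕ) (Φ : Set (Constraint BV Var UnrSuff))
    (hdim : ∀ φ ∈ Φ, φ.P.card ≤ K) (hgood : ∀ φ ∈ Φ, ConstraintBGood B φ) :
    IsWQOOn Φ (Entails star starU) := by
  intro f hf
  obtain ⟨i, j, hij, hglobal, τ, hτ, hkey⟩ := exists_lt_colorLe_and_image_eq
    (fun n => (f n).globalKey K) (fun n => (f n).T) (fun n => (f n).taskKey K B)
  exact ⟨i, j, hij, entails_of_colorLe (hdim _ (hf i)) (hdim _ (hf j)) (hgood _ (hf i))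
    (hgood _ (hf j)) hglobal hτ hkey⟩
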